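/- Let k, μ ∈ ℂ with μ² = 2 + k², 1 − k² − 2ik ≠ 0 and 3 + k² + 2μ ≠ 0. Define the ℂ²-valued functions f₁(x) = e^{ikx}(1−k²−2ik)^{−1}·(1−k²−2ik·tanh x − sech²x, −sech²x), f₃(x) = e^{−μx}(3+k²+2μ)^{−1}·(−sech²x, 3+k²+2μ·tanh x − sech²x), g₁(x) = f₁(−x), g₃(x) = f₃(−x), and for ℂ²-valued f = (f¹,f²), g = (g¹,g²) the Wronskian W[f,g](x) = (f¹)'(x)g¹(x) + (f²)'(x)g²(x) − f¹(x)(g¹)'(x) − f²(x)(g²)'(x). Then for every x ∈ ℝ, W[f₁,g₁](x)·W[f₃,g₃](x) − W[f₁,g₃](x)·W[f₃,g₁](x) = −4ik·((1−k²+2ik)/(1−k²−2ik))·μ·((3+k²−2μ)/(3+k²+2μ)); in particular this determinant of Wronskians is independent of x. -/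

import Mathlib

open Complex

/-- The explicit Jost solution `f₁(·,k)` at `p = 3`. -/
noncomputable def jostF1 (k : ℂ) (x : ℝ) : ℂ × ℂ :=
  (Complex.exp (I * k * (x : ℂ)) * (1 - k ^ 2 - 2 * I * k)⁻¹ *
      (1 - k ^ 2 - 2 * I * k * (Real.tanh x : ℂ) - ((Real.cosh x : ℂ))⁻¹ ^ 2),
   Complex.exp (I * k * (x : ℂ)) * (1 - k ^ 2 - 2 * I * k)⁻¹ *
      (-(((Real.cosh x : ℂ))⁻¹ ^ 2)))

/-- The explicit Jost solution `f₃(·,k)` at `p = 3` (with `μ = √(2+k²)`). -/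
noncomputable def jostF3 (k μ : ℂ) (x : ℝ) : ℂ × ℂ :=
  (Complex.exp (-(μ * (x : ℂ))) * (3 + k ^ 2 + 2 * μ)⁻¹ *
      (-(((Real.cosh x : ℂ))⁻¹ ^ 2)),
   Complex.exp (-(μ * (x : ℂ))) * (3 + k ^ 2 + 2 * μ)⁻¹ *
      (3 + k ^ 2 + 2 * μ * (Real.tanh x : ℂ) - ((Real.cosh x : ℂ))⁻¹ ^ 2))

/-- The Wronskian `W[f,g](x) = f'(x)ᵀ g(x) − f(x)ᵀ g'(x)` of two `ℂ²`-valued functions. -/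
noncomputable def wronsk (f g : ℝ → ℂ × ℂ) (x : ℝ) : ℂ :=
  deriv (fun y : ℝ => (f y).1) x * (g x).1 + deriv (fun y : ℝ => (f y).2) x * (g x).2
    - (f x).1 * deriv (fun y : ℝ => (g y).1) x - (f x).2 * deriv (fun y : ℝ => (g y).2) x

/-- The derivative of `tanh`, viewed as a complex-valued function, is `1 - tanh²`. -/
theorem hasDerivAt_ofReal_tanh (x : ℝ) :
    HasDerivAt (fun y : ℝ => (Real.tanh y : ℂ)) (1 - (Real.tanh x : ℂ) ^ 2) x := by
  have hc : Real.cosh x ≠ 0 := (Real.cosh_pos x).ne'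
  have h := (Real.hasDerivAt_sinh x).div (Real.hasDerivAt_cosh x) hc
  have hfun : Real.sinh / Real.cosh = Real.tanh :=
    funext fun y => (Real.tanh_eq_sinh_div_cosh y).symm
  rw [hfun] at h
  have hval : (Real.cosh x * Real.cosh x - Real.sinh x * Real.sinh x) / Real.cosh x ^ 2
      = 1 - Real.tanh x ^ 2 := by
    rw [Real.tanh_eq_sinh_div_cosh]
    field_simp
  rw [hval] at h
  simpa using h.ofReal_comp

theorem inv_cosh_sq_eq_one_sub_tanh_sq (x : ℝ) :
    ((Real.cosh x : ℂ))⁻¹ ^ 2 = 1 - (Real.tanh x : ℂ) ^ 2 := by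
  have hc : Real.cosh x ≠ 0 := (Real.cosh_pos x).ne'
  have h : (Real.cosh x)⁻¹ ^ 2 = 1 - Real.tanh x ^ 2 := by
    rw [Real.tanh_eq_sinh_div_cosh]
    field_simp
    linarith [Real.cosh_sq x]
  exact_mod_cast congrArg (fun r : ℝ => (r : ℂ)) h

/-- An exponential times a quadratic polynomial in `tanh`. -/
noncomputable def expTanh (c N a b d : ℂ) (x : ℝ) : ℂ :=
  Complex.exp (c * x) * N * (a + b * (Real.tanh x : ℂ) + d * (Real.tanh x : ℂ) ^ 2)

theorem deriv_expTanh (c N a b d : ℂ) (x : ℝ) :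
    deriv (expTanh c N a b d) x = Complex.exp (c * x) * N *
      (c * (a + b * (Real.tanh x : ℂ) + d * (Real.tanh x : ℂ) ^ 2)
        + (b + 2 * d * (Real.tanh x : ℂ)) * (1 - (Real.tanh x : ℂ) ^ 2)) := by
  have ht := hasDerivAt_ofReal_tanh x
  have he : HasDerivAt (fun y : ℝ => Complex.exp (c * y)) (Complex.exp (c * x) * (c * 1)) x :=
    ((HasDerivAt.ofReal_comp (hasDerivAt_id x)).const_mul c).cexp
  have h := (he.mul_const N).mul (((ht.const_mul b).const_add a).add ((ht.pow 2).const_mul d))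
  refine (h.congr_deriv ?_).deriv
  simp
  ring

/-- The Wronskian of two pairs of functions of the form `expTanh`. -/
theorem wronsk_expTanh (c N a b d a' b' d' C M p q r p' q' r' : ℂ) (x : ℝ) (t : ℂ)
    (ht : t = (Real.tanh x : ℂ)) :
    wronsk (fun y => (expTanh c N a b d y, expTanh c N a' b' d' y))
        (fun y => (expTanh C M p q r y, expTanh C M p' q' r' y)) x
      = Complex.exp (c * x) * Complex.exp (C * x) * N * M *
        ((c - C) * ((a + b * t + d * t ^ 2) * (p + q * t + r * t ^ 2)
            + (a' + b' * t + d' * t ^ 2) * (p' + q' * t + r' * t ^ 2))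
          + (1 - t ^ 2) * ((b + 2 * d * t) * (p + q * t + r * t ^ 2)
            + (b' + 2 * d' * t) * (p' + q' * t + r' * t ^ 2)
            - (a + b * t + d * t ^ 2) * (q + 2 * r * t)
            - (a' + b' * t + d' * t ^ 2) * (q' + 2 * r' * t))) := by
  subst ht
  simp only [wronsk]
  rw [deriv_expTanh c N a b d, deriv_expTanh c N a' b' d', deriv_expTanh C M p q r,
    deriv_expTanh C M p' q' r']
  simp only [expTanh]
  ring

theorem jostF1_eq_expTanh (k : ℂ) :
    jostF1 k = fun y => (expTanh (I * k) (1 - k ^ 2 - 2 * I * k)⁻¹ (-k ^ 2) (-2 * (I * k)) 1 y,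
      expTanh (I * k) (1 - k ^ 2 - 2 * I * k)⁻¹ (-1) 0 1 y) := by
  funext y
  simp only [jostF1, expTanh, inv_cosh_sq_eq_one_sub_tanh_sq]
  ext <;> ring

theorem jostF1_neg_eq_expTanh (k : ℂ) :
    (fun y : ℝ => jostF1 k (-y)) =
      fun y => (expTanh (-(I * k)) (1 - k ^ 2 - 2 * I * k)⁻¹ (-k ^ 2) (2 * (I * k)) 1 y,
        expTanh (-(I * k)) (1 - k ^ 2 - 2 * I * k)⁻¹ (-1) 0 1 y) := by
  funext y
  simp only [jostF1, expTanh, inv_cosh_sq_eq_one_sub_tanh_sq, Real.tanh_neg, ofReal_neg, mul_neg,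
    neg_mul]
  ext <;> ring

theorem jostF3_eq_expTanh (k μ : ℂ) :
    jostF3 k μ = fun y => (expTanh (-μ) (3 + k ^ 2 + 2 * μ)⁻¹ (-1) 0 1 y,
      expTanh (-μ) (3 + k ^ 2 + 2 * μ)⁻¹ (2 + k ^ 2) (2 * μ) 1 y) := by
  funext y
  simp only [jostF3, expTanh, inv_cosh_sq_eq_one_sub_tanh_sq, neg_mul]
  ext <;> ring

theorem jostF3_neg_eq_expTanh (k μ : ℂ) :
    (fun y : ℝ => jostF3 k μ (-y)) =
      fun y => (expTanh μ (3 + k ^ 2 + 2 * μ)⁻¹ (-1) 0 1 y,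
        expTanh μ (3 + k ^ 2 + 2 * μ)⁻¹ (2 + k ^ 2) (-2 * μ) 1 y) := by
  funext y
  simp only [jostF3, expTanh, inv_cosh_sq_eq_one_sub_tanh_sq, Real.tanh_neg, ofReal_neg, mul_neg,
    neg_mul, neg_neg]
  ext <;> ring

theorem wronsk_jostF1_jostF1_neg (k : ℂ) (h1 : 1 - k ^ 2 - 2 * I * k ≠ 0) (x : ℝ) :
    wronsk (jostF1 k) (fun y : ℝ => jostF1 k (-y)) x
      = 2 * I * k * ((1 - k ^ 2 + 2 * I * k) / (1 - k ^ 2 - 2 * I * k)) := by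
  have he : Complex.exp (I * k * x) * Complex.exp (-(I * k) * x) = 1 := by
    rw [← Complex.exp_add]
    simp
  have hκ : k ^ 2 = -(I * k) ^ 2 := by
    rw [mul_pow, I_sq]
    ring
  rw [jostF1_neg_eq_expTanh, jostF1_eq_expTanh, wronsk_expTanh (ht := rfl), he]
  rw [mul_assoc 2 I k, hκ] at h1 ⊢
  clear hκ he
  generalize I * k = κ at *
  generalize (Real.tanh x : ℂ) = t
  have hsq : 1 - -κ ^ 2 - 2 * κ = (1 - κ) ^ 2 := by ring
  rw [hsq] at h1 ⊢
  have hne : 1 - κ ≠ 0 := ne_zero_pow two_ne_zero h1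
  field_simp
  ring

theorem wronsk_jostF3_jostF3_neg (k μ : ℂ) (hμ : μ ^ 2 = 2 + k ^ 2)
    (h3 : 3 + k ^ 2 + 2 * μ ≠ 0) (x : ℝ) :
    wronsk (jostF3 k μ) (fun y : ℝ => jostF3 k μ (-y)) x
      = -2 * μ * ((3 + k ^ 2 - 2 * μ) / (3 + k ^ 2 + 2 * μ)) := by
  have he : Complex.exp (-μ * x) * Complex.exp (μ * x) = 1 := by
    rw [← Complex.exp_add]
    simp
  have hk : k ^ 2 = μ ^ 2 - 2 := by rw [hμ]; ring
  rw [jostF3_neg_eq_expTanh, jostF3_eq_expTanh, wronsk_expTanh (ht := rfl), he]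
  rw [hk] at h3 ⊢
  generalize (Real.tanh x : ℂ) = t
  have hsq : 3 + (μ ^ 2 - 2) + 2 * μ = (1 + μ) ^ 2 := by ring
  rw [hsq] at h3 ⊢
  have hne : 1 + μ ≠ 0 := ne_zero_pow two_ne_zero h3
  field_simp
  ring

theorem wronsk_jostF1_jostF3_neg (k μ : ℂ) (hμ : μ ^ 2 = 2 + k ^ 2) (x : ℝ) :
    wronsk (jostF1 k) (fun y : ℝ => jostF3 k μ (-y)) x = 0 := by
  have hκ : k ^ 2 = -(I * k) ^ 2 := by
    rw [mul_pow, I_sq]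
    ring
  rw [jostF3_neg_eq_expTanh, jostF1_eq_expTanh, wronsk_expTanh (ht := rfl)]
  refine mul_eq_zero_of_right _ ?_
  rw [hκ] at hμ ⊢
  clear hκ
  generalize I * k = κ at *
  generalize (Real.tanh x : ℂ) = t
  have hk : κ ^ 2 = 2 - μ ^ 2 := by rw [hμ]; ring
  linear_combination 2 * t * (t ^ 2 - 1) * hk

/-- the determinant of the matrix of Wronskians of the `p = 3` Jost
solutions is independent of `x` and equals the explicit value
`−4ik ((1−k²+2ik)/(1−k²−2ik)) μ ((3+k²−2μ)/(3+k²+2μ))`. -/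
theorem stmt_9 (k μ : ℂ) (hμ : μ ^ 2 = 2 + k ^ 2)
    (h1 : 1 - k ^ 2 - 2 * I * k ≠ 0) (h3 : 3 + k ^ 2 + 2 * μ ≠ 0)
    (f₁ f₃ g₁ g₃ : ℝ → ℂ × ℂ)
    (hf₁ : f₁ = jostF1 k) (hf₃ : f₃ = jostF3 k μ)
    (hg₁ : g₁ = fun x : ℝ => jostF1 k (-x)) (hg₃ : g₃ = fun x : ℝ => jostF3 k μ (-x)) :
    ∀ x : ℝ,
      wronsk f₁ g₁ x * wronsk f₃ g₃ x - wronsk f₁ g₃ x * wronsk f₃ g₁ x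
        = -4 * I * k * ((1 - k ^ 2 + 2 * I * k) / (1 - k ^ 2 - 2 * I * k)) * μ *
            ((3 + k ^ 2 - 2 * μ) / (3 + k ^ 2 + 2 * μ)) := by
  intro x
  subst hf₁ hf₃ hg₁ hg₃
  rw [wronsk_jostF1_jostF1_neg k h1, wronsk_jostF3_jostF3_neg k μ hμ h3,
    wronsk_jostF1_jostF3_neg k μ hμ]
  ring
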